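/- Let K be an algebraically closed field of characteristic zero and n = 3. Let F ∈ K[x_0,x_1,x_2,x_3] be any one of the quartics F_7 = x_0(x_0+x_1)(x_1^2+x_2^2+x_3^2), F_{8,λ} = x_0(λx_0+x_1)(x_0^2+x_1^2+x_2^2+x_3^2) with λ ∈ K, λ ≠ 0, F_9 = x_0x_1(x_0^2+x_1x_2+x_3^2), or F_{10,λ} = x_0(−λ^2x_0+x_1+λx_2)(x_0x_1+x_2^2+x_3^2) with λ ∈ K. Then rk(F) ≥ 9, i.e., rk(F) > 4(n−1) = 8. -/

import Mathlib

open MvPolynomial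

/-- Apply the iterated partial-derivative operator `∏ i, (∂/∂xᵢ)^(d i)` to `F`. -/
noncomputable def diffOp {K : Type*} [CommSemiring K] {m : ℕ} (d : Fin m →₀ ℕ)
    (F : MvPolynomial (Fin m) K) : MvPolynomial (Fin m) K :=
  (List.finRange m).foldr (fun i G => (⇑(MvPolynomial.pderiv i))^[d i] G) F

/-- Apolarity action: apply the differential polynomial `δ` (in the dual variables)
to the polynomial `F`. -/
noncomputable def applyDiff {K : Type*} [CommSemiring K] {m : ℕ}
    (δ F : MvPolynomial (Fin m) K) : MvPolynomial (Fin m) K :=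
  δ.support.sum fun d => δ.coeff d • diffOp d F

/-- `IsWaringDecomp F d r`: the degree-`d` form `F` lies in the linear span of the
`d`-th powers of `r` linear forms. -/
def IsWaringDecomp {K : Type*} [Field K] {m : ℕ} (F : MvPolynomial (Fin m) K)
    (d r : ℕ) : Prop :=
  ∃ ℓ : Fin r → MvPolynomial (Fin m) K,
    (∀ j, (ℓ j).IsHomogeneous 1) ∧
    F ∈ Submodule.span K (Set.range fun j => ℓ j ^ d)

/-- The symmetric (Waring) rank of a degree-`d` form. -/
noncomputable def waringRank {K : Type*} [Field K] {m : ℕ}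
    (F : MvPolynomial (Fin m) K) (d : ℕ) : ℕ :=
  sInf {r | IsWaringDecomp F d r}

/-- `∑_{i ≥ t} x_i²`. -/
noncomputable def sumSqFrom (K : Type*) [CommSemiring K] (m t : ℕ) :
    MvPolynomial (Fin m) K :=
  ∑ i ∈ Finset.univ.filter (fun i : Fin m => t ≤ (i : ℕ)), X i ^ 2

/-- The linear form `∑ⱼ aⱼ xⱼ`. -/
noncomputable def linForm {K : Type*} [CommSemiring K] {m : ℕ} (a : Fin m → K) :
    MvPolynomial (Fin m) K :=
  ∑ j, C (a j) * X j

section Waring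

variable {K : Type*} [Field K] {m : ℕ}

lemma exists_eq_linForm {ℓ : MvPolynomial (Fin m) K} (h : ℓ.IsHomogeneous 1) :
    ∃ a, ℓ = linForm a := by
  have hℓ : ℓ ∈ homogeneousSubmodule (Fin m) K 1 := h
  rw [homogeneousSubmodule_one_eq_span_X, Submodule.mem_span_range_iff_exists_fun] at hℓ
  obtain ⟨a, ha⟩ := hℓ
  exact ⟨a, by simp [linForm, ← ha, smul_eq_C_mul]⟩

lemma pderiv_linForm (a : Fin m → K) (i : Fin m) : pderiv i (linForm a) = C (a i) := by
  simp [linForm, pderiv_X, Pi.single_apply]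

lemma IsWaringDecomp.mono {F : MvPolynomial (Fin m) K} {d r s : ℕ}
    (h : IsWaringDecomp F d r) (hrs : r ≤ s) : IsWaringDecomp F d s := by
  obtain ⟨ℓ, hℓ, hF⟩ := h
  refine ⟨fun i => if hi : (i : ℕ) < r then ℓ ⟨i, hi⟩ else 0, fun i => ?_,
    Submodule.span_mono ?_ hF⟩
  · by_cases hi : (i : ℕ) < r
    · simpa [hi] using hℓ _
    · simpa [hi] using isHomogeneous_zero _ _ _
  · rintro _ ⟨j, rfl⟩
    exact ⟨Fin.castLE hrs j, by simp⟩

/-- Over an algebraically closed field the coefficients of a Waring decomposition can be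
absorbed into the linear forms. -/
lemma IsWaringDecomp.exists_eq_sum [IsAlgClosed K] {F : MvPolynomial (Fin m) K} {d r : ℕ}
    (hd : 0 < d) (h : IsWaringDecomp F d r) :
    ∃ p : Fin r → Fin m → K, F = ∑ i, linForm (p i) ^ d := by
  obtain ⟨ℓ, hℓ, hF⟩ := h
  obtain ⟨c, rfl⟩ := (Submodule.mem_span_range_iff_exists_fun K).1 hF
  choose a ha using fun i => exists_eq_linForm (hℓ i)
  choose t ht using fun i => IsAlgClosed.exists_pow_nat_eq (c i) hd
  refine ⟨fun i j => t i * a i j, Finset.sum_congr rfl fun i _ => ?_⟩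
  have : linForm (fun j => t i * a i j) = C (t i) * linForm (a i) := by
    simp [linForm, Finset.mul_sum, mul_assoc]
  rw [this, mul_pow, ← C_pow, ht, ha, smul_eq_C_mul]

/-- The span of all fourth powers of linear forms. -/
noncomputable def fourthPowerSpan (K : Type*) [Field K] (m : ℕ) :
    Submodule K (MvPolynomial (Fin m) K) :=
  Submodule.span K {G | ∃ ℓ : MvPolynomial (Fin m) K, ℓ.IsHomogeneous 1 ∧ G = ℓ ^ 4}

lemma exists_isWaringDecomp {F : MvPolynomial (Fin m) K} (hF : F ∈ fourthPowerSpan K m) :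
    ∃ r, IsWaringDecomp F 4 r := by
  obtain ⟨r, c, g, rfl⟩ := Submodule.mem_span_set'.1 hF
  choose ℓ hℓ hg using fun i => (g i).2
  refine ⟨r, ℓ, hℓ, Submodule.sum_mem _ fun i _ => Submodule.smul_mem _ _ ?_⟩
  rw [hg]
  exact Submodule.subset_span ⟨i, rfl⟩

lemma mul_mem_fourthPowerSpan [CharZero K] {a b c d : MvPolynomial (Fin m) K}
    (ha : a.IsHomogeneous 1) (hb : b.IsHomogeneous 1) (hc : c.IsHomogeneous 1)
    (hd : d.IsHomogeneous 1) : a * b * (c * d) ∈ fourthPowerSpan K m := by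
  have key : ∀ ℓ : MvPolynomial (Fin m) K, ℓ.IsHomogeneous 1 → ℓ ^ 4 ∈ fourthPowerSpan K m :=
    fun ℓ hℓ => Submodule.subset_span ⟨ℓ, hℓ, rfl⟩
  have h192 : a * b * (c * d) = (192⁻¹ : K) •
      ((a + b + c + d) ^ 4 - (a + b + c - d) ^ 4 - (a + b - c + d) ^ 4 + (a + b - c - d) ^ 4
        - (a - b + c + d) ^ 4 + (a - b + c - d) ^ 4 + (a - b - c + d) ^ 4
        - (a - b - c - d) ^ 4) := by
    rw [eq_inv_smul_iff₀ (by norm_num), smul_eq_C_mul, show C (192 : K) = 192 from map_ofNat C 192]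
    ring
  rw [h192]
  exact Submodule.smul_mem _ _ <| sub_mem (add_mem (add_mem (sub_mem (add_mem (sub_mem (sub_mem
    (key _ (((ha.add hb).add hc).add hd)) (key _ (((ha.add hb).add hc).sub hd)))
    (key _ (((ha.add hb).sub hc).add hd))) (key _ (((ha.add hb).sub hc).sub hd)))
    (key _ (((ha.sub hb).add hc).add hd))) (key _ (((ha.sub hb).add hc).sub hd)))
    (key _ (((ha.sub hb).sub hc).add hd))) (key _ (((ha.sub hb).sub hc).sub hd))

lemma pderiv_pderiv_sum_pow_four {r : ℕ} (p : Fin r → Fin m → K) (a b : Fin m) :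
    pderiv a (pderiv b (∑ i, linForm (p i) ^ 4)) =
      ∑ i, C (12 * (p i a * p i b)) * linForm (p i) ^ 2 := by
  simp only [map_sum, pderiv_pow, pderiv_linForm, Derivation.leibniz, pderiv_C, smul_eq_mul]
  refine Finset.sum_congr rfl fun i _ => ?_
  simp only [C_mul, show C (12 : K) = 12 from map_ofNat C 12, Derivation.map_natCast]
  push_cast
  ring

/-- A linear relation between the quadratic monomials at the points of a decomposition
annihilates the form. -/
lemma sum_eval_pderiv_eq_zero {r n : ℕ} {p : Fin r → Fin m → K} {F : MvPolynomial (Fin m) K}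
    (hF : F = ∑ i, linForm (p i) ^ 4) (e : Fin n → Fin m × Fin m) (g : Fin n → K)
    (hg : ∀ i, ∑ k, g k * (p i (e k).1 * p i (e k).2) = 0) (x : Fin m → K) :
    ∑ k, g k * eval x (pderiv (e k).1 (pderiv (e k).2 F)) = 0 := by
  simp only [hF, pderiv_pderiv_sum_pow_four]
  simp only [map_sum, map_mul, eval_C, Finset.mul_sum]
  rw [Finset.sum_comm]
  refine Finset.sum_eq_zero fun i _ => ?_
  have := congrArg (12 * eval x (linForm (p i) ^ 2) * ·) (hg i)
  simp only [Finset.mul_sum, mul_zero] at this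
  rw [← this]
  exact Finset.sum_congr rfl fun k _ => by ring

lemma sum_mul_eq_zero_of_pderiv_eq_zero [CharZero K] {r : ℕ} {p : Fin r → Fin m → K}
    {F : MvPolynomial (Fin m) K} (hF : F = ∑ i, linForm (p i) ^ 4) {a b : Fin m}
    (h : pderiv a (pderiv b F) = 0) (c d : Fin m) :
    ∑ i, p i c * p i d * (p i a * p i b) = 0 := by
  have h4 := congrArg (fun G => eval (0 : Fin m → K) (pderiv c (pderiv d G))) h
  simp only [hF, pderiv_pderiv_sum_pow_four] at h4
  simp only [pow_two, map_sum, map_add, map_mul, map_zero, Derivation.leibniz, pderiv_C,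
    pderiv_linForm, smul_eq_mul, eval_C, mul_zero, add_zero] at h4
  have : (24 : K) * ∑ i, p i c * p i d * (p i a * p i b) = 0 := by
    rw [← h4, Finset.mul_sum]
    exact Finset.sum_congr rfl fun i _ => by ring
  simpa using this

lemma exists_relation {r n : ℕ} (hrn : r < n) (p : Fin r → Fin m → K)
    (e : Fin n → Fin m × Fin m) :
    ∃ g : Fin n → K, g ≠ 0 ∧ ∀ i, ∑ k, g k * (p i (e k).1 * p i (e k).2) = 0 := by
  have h : ¬ LinearIndependent K (fun k i => p i (e k).1 * p i (e k).2 : Fin n → Fin r → K) :=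
    fun h => by
      have := h.fintype_card_le_finrank
      simp only [Fintype.card_fin, Module.finrank_fin_fun] at this
      omega
  obtain ⟨g, hg, k, hk⟩ := Fintype.not_linearIndependent_iff.1 h
  exact ⟨g, fun h0 => hk (by simp [h0]), fun i => by simpa using congrFun hg i⟩

lemma exists_relation_of_orthogonal {r : ℕ} (p : Fin r → Fin m → K)
    (e : Fin r → Fin m × Fin m) {u : Fin r → K} (hu : u ≠ 0)
    (h : ∀ k, ∑ i, p i (e k).1 * p i (e k).2 * u i = 0) :
    ∃ g : Fin r → K, g ≠ 0 ∧ ∀ i, ∑ k, g k * (p i (e k).1 * p i (e k).2) = 0 := by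
  let M : Matrix (Fin r) (Fin r) K := fun k i => p i (e k).1 * p i (e k).2
  have hM : M.det = 0 := Matrix.exists_mulVec_eq_zero_iff.1 ⟨u, hu, funext h⟩
  obtain ⟨g, hg, hgM⟩ := Matrix.exists_vecMul_eq_zero_iff.2 hM
  exact ⟨g, hg, fun i => congrFun hgM i⟩

/-- The ten quadratic monomials in four variables. -/
def quadMonomials : Fin 10 → Fin 4 × Fin 4 :=
  ![(0, 0), (0, 1), (0, 2), (0, 3), (1, 1), (1, 2), (1, 3), (2, 2), (2, 3), (3, 3)]

/-- Eight points lie on a pencil of quadrics, so some quadric through them omits any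
prescribed monomial. -/
lemma exists_quadric_coeff_eq_zero (p : Fin 8 → Fin 4 → K) (j : Fin 10) :
    ∃ g : Fin 10 → K, g ≠ 0 ∧ g j = 0 ∧
      ∀ i, ∑ k, g k * (p i (quadMonomials k).1 * p i (quadMonomials k).2) = 0 := by
  obtain ⟨g, hg0, hg⟩ :=
    exists_relation (Nat.lt_succ_self 8) p (fun k => quadMonomials (j.succAbove k))
  refine ⟨j.insertNth 0 g, fun h => hg0 (funext fun k => ?_), by simp, fun i => ?_⟩
  · simpa using congrFun h (j.succAbove k)
  · simpa [Fin.sum_univ_succAbove _ j] using hg i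

end Waring
lemma sumSqFrom_zero (K : Type*) [CommSemiring K] :
    sumSqFrom K 4 0 = X 0 ^ 2 + X 1 ^ 2 + X 2 ^ 2 + X 3 ^ 2 := by
  simp [sumSqFrom, Fin.sum_univ_four]

lemma sumSqFrom_one (K : Type*) [CommSemiring K] :
    sumSqFrom K 4 1 = X 1 ^ 2 + X 2 ^ 2 + X 3 ^ 2 := by
  simp [sumSqFrom, Finset.sum_filter, Fin.sum_univ_four]

lemma sumSqFrom_two (K : Type*) [CommSemiring K] :
    sumSqFrom K 4 2 = X 2 ^ 2 + X 3 ^ 2 := by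
  simp [sumSqFrom, Finset.sum_filter, Fin.sum_univ_four]

lemma sumSqFrom_three (K : Type*) [CommSemiring K] : sumSqFrom K 4 3 = X 3 ^ 2 := by
  simp [sumSqFrom, Finset.sum_filter, Fin.sum_univ_four]

/-- `x₀(x₀+x₁)(x₁²+x₂²+x₃²)` is not a sum of eight fourth powers of linear forms. -/
lemma cone_quartic_ne_sum_pow {K : Type*} [Field K] [CharZero K] (p : Fin 8 → Fin 4 → K) :
    X 0 * (X 0 + X 1) * (X 1 ^ 2 + X 2 ^ 2 + X 3 ^ 2) ≠
      ∑ i, linForm (p i) ^ 4 := by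
  intro hF
  have coeffs : ∀ g : Fin 10 → K,
      (∀ i, ∑ k, g k * (p i (quadMonomials k).1 * p i (quadMonomials k).2) = 0) →
      g 0 = 0 ∧ g 1 = 0 ∧ g 2 = 0 ∧ g 3 = 0 ∧ g 4 = 0 ∧ g 5 = 0 ∧ g 6 = 0 ∧ g 7 = -g 9 := by
    intro g hg
    have h := fun x y z w => sum_eval_pderiv_eq_zero hF quadMonomials g hg ![x, y, z, w]
    simp [quadMonomials, Fin.sum_univ_succ, pow_two, Derivation.leibniz, pderiv_X,
      Pi.single_apply] at h
    have h0 := h 1 0 0 0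
    have h1 := h 0 1 0 0
    have h2 := h 0 0 1 0
    have h3 := h 0 0 0 1
    have h01 := h 1 1 0 0
    have h02 := h 1 0 1 0
    have h03 := h 1 0 0 1
    have h12 := h 0 1 1 0
    have h13 := h 0 1 0 1
    have h23 := h 0 0 1 1
    clear h
    simp at h0 h1 h2 h3 h01 h02 h03 h12 h13 h23
    grind
  have hA : ∀ i, p i 2 ^ 2 = p i 3 ^ 2 := by
    obtain ⟨g, hg0, hgj, hg⟩ := exists_quadric_coeff_eq_zero p 8
    have hc := coeffs g hg
    have h9 : g 9 ≠ 0 := fun h => hg0 (by ext k; fin_cases k <;> simp <;> grind)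
    intro i
    have hi := hg i
    simp [quadMonomials, Fin.sum_univ_succ] at hi
    grind
  have hB : ∀ i, p i 2 * p i 3 = 0 := by
    obtain ⟨g, hg0, hgj, hg⟩ := exists_quadric_coeff_eq_zero p 9
    have hc := coeffs g hg
    have h8 : g 8 ≠ 0 := fun h => hg0 (by ext k; fin_cases k <;> simp <;> grind)
    intro i
    have hi := hg i
    simp [quadMonomials, Fin.sum_univ_succ] at hi
    grind
  have h3 : ∀ i, p i 3 = 0 := by grind
  have h := sum_eval_pderiv_eq_zero hF ![((3 : Fin 4), (3 : Fin 4))] ![1] (by simp [h3])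
    ![1, 0, 0, 0]
  simp [pow_two, Derivation.leibniz, pderiv_X] at h

/-- `x₀(λx₀+x₁)(x₀²+x₁²+x₂²+x₃²)` with `λ ≠ 0` is not a sum of eight fourth powers. -/
lemma sphere_quartic_ne_sum_pow {K : Type*} [Field K] [CharZero K] {lam : K} (hlam : lam ≠ 0)
    (p : Fin 8 → Fin 4 → K) :
    X 0 * (C lam * X 0 + X 1) * (X 0 ^ 2 + X 1 ^ 2 + X 2 ^ 2 + X 3 ^ 2) ≠
      ∑ i, linForm (p i) ^ 4 := by
  intro hF
  have coeffs : ∀ g : Fin 10 → K,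
      (∀ i, ∑ k, g k * (p i (quadMonomials k).1 * p i (quadMonomials k).2) = 0) →
      g 0 = 0 ∧ g 1 = 0 ∧ g 2 = 0 ∧ g 3 = 0 ∧ g 4 = 0 ∧ g 5 = 0 ∧ g 6 = 0 ∧ g 7 = -g 9 := by
    intro g hg
    have h := fun x y z w => sum_eval_pderiv_eq_zero hF quadMonomials g hg ![x, y, z, w]
    simp [quadMonomials, Fin.sum_univ_succ, pow_two, Derivation.leibniz, pderiv_X,
      Pi.single_apply] at h
    have h0 := h 1 0 0 0
    have h1 := h 0 1 0 0
    have h2 := h 0 0 1 0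
    have h3 := h 0 0 0 1
    have h01 := h 1 1 0 0
    have h02 := h 1 0 1 0
    have h03 := h 1 0 0 1
    have h12 := h 0 1 1 0
    have h13 := h 0 1 0 1
    have h23 := h 0 0 1 1
    clear h
    simp at h0 h1 h2 h3 h01 h02 h03 h12 h13 h23
    grind
  have hA : ∀ i, p i 2 ^ 2 = p i 3 ^ 2 := by
    obtain ⟨g, hg0, hgj, hg⟩ := exists_quadric_coeff_eq_zero p 8
    have hc := coeffs g hg
    have h9 : g 9 ≠ 0 := fun h => hg0 (by ext k; fin_cases k <;> simp <;> grind)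
    intro i
    have hi := hg i
    simp [quadMonomials, Fin.sum_univ_succ] at hi
    grind
  have hB : ∀ i, p i 2 * p i 3 = 0 := by
    obtain ⟨g, hg0, hgj, hg⟩ := exists_quadric_coeff_eq_zero p 9
    have hc := coeffs g hg
    have h8 : g 8 ≠ 0 := fun h => hg0 (by ext k; fin_cases k <;> simp <;> grind)
    intro i
    have hi := hg i
    simp [quadMonomials, Fin.sum_univ_succ] at hi
    grind
  have h3 : ∀ i, p i 3 = 0 := by grind
  have h := sum_eval_pderiv_eq_zero hF ![((3 : Fin 4), (3 : Fin 4))] ![1] (by simp [h3])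
    ![1, 0, 0, 0]
  simp [pow_two, Derivation.leibniz, pderiv_X] at h
  exact hlam h

set_option maxHeartbeats 800000 in
/-- `x₀(−λ²x₀+x₁+λx₂)(x₀x₁+x₂²+x₃²)` is not a sum of eight fourth powers. -/
lemma two_tangent_quartic_ne_sum_pow {K : Type*} [Field K] [CharZero K] (lam : K)
    (p : Fin 8 → Fin 4 → K) :
    X 0 * (C (-lam ^ 2) * X 0 + X 1 + C lam * X 2) * (X 0 * X 1 + (X 2 ^ 2 + X 3 ^ 2)) ≠
      ∑ i, linForm (p i) ^ 4 := by
  intro hF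
  have coeffs : ∀ g : Fin 10 → K,
      (∀ i, ∑ k, g k * (p i (quadMonomials k).1 * p i (quadMonomials k).2) = 0) →
      g 0 = 0 ∧ g 1 = 0 ∧ g 2 = 0 ∧ g 3 = 0 ∧ g 4 = -lam ^ 2 * g 9 ∧ g 5 = 2 * lam * g 9 ∧
        g 6 = -lam * g 8 ∧ g 7 = -g 9 := by
    intro g hg
    have h := fun x y z w => sum_eval_pderiv_eq_zero hF quadMonomials g hg ![x, y, z, w]
    simp [quadMonomials, Fin.sum_univ_succ, pow_two, Derivation.leibniz, pderiv_X,
      Pi.single_apply] at h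
    have h0 := h 1 0 0 0
    have h1 := h 0 1 0 0
    have h2 := h 0 0 1 0
    have h3 := h 0 0 0 1
    have h01 := h 1 1 0 0
    have h02 := h 1 0 1 0
    have h03 := h 1 0 0 1
    have h12 := h 0 1 1 0
    have h13 := h 0 1 0 1
    have h23 := h 0 0 1 1
    clear h
    simp at h0 h1 h2 h3 h01 h02 h03 h12 h13 h23
    grind
  have hA : ∀ i, (p i 2 - lam * p i 1) ^ 2 = p i 3 ^ 2 := by
    obtain ⟨g, hg0, hgj, hg⟩ := exists_quadric_coeff_eq_zero p 8
    have hc := coeffs g hg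
    have h9 : g 9 ≠ 0 := fun h => hg0 (by ext k; fin_cases k <;> simp <;> grind)
    intro i
    have hi := hg i
    simp [quadMonomials, Fin.sum_univ_succ] at hi
    grind
  have hB : ∀ i, (p i 2 - lam * p i 1) * p i 3 = 0 := by
    obtain ⟨g, hg0, hgj, hg⟩ := exists_quadric_coeff_eq_zero p 9
    have hc := coeffs g hg
    have h8 : g 8 ≠ 0 := fun h => hg0 (by ext k; fin_cases k <;> simp <;> grind)
    intro i
    have hi := hg i
    simp [quadMonomials, Fin.sum_univ_succ] at hi
    grind
  have h3 : ∀ i, p i 3 = 0 := by grind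
  have h := sum_eval_pderiv_eq_zero hF ![((3 : Fin 4), (3 : Fin 4))] ![1] (by simp [h3])
    ![1, lam ^ 2 + 1, 0, 0]
  simp [pow_two, Derivation.leibniz, pderiv_X] at h

/-- `x₀x₁(x₀²+x₁x₂+x₃²)` is not a sum of eight fourth powers. -/
lemma tangent_quartic_ne_sum_pow {K : Type*} [Field K] [CharZero K] (p : Fin 8 → Fin 4 → K) :
    X 0 * X 1 * (X 0 ^ 2 + X 1 * X 2 + X 3 ^ 2) ≠ ∑ i, linForm (p i) ^ 4 := by
  intro hF
  have hd : pderiv 2 (pderiv 2 (X 0 * X 1 * (X 0 ^ 2 + X 1 * X 2 + X 3 ^ 2) :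
      MvPolynomial (Fin 4) K)) = 0 := by
    simp [pow_two, Derivation.leibniz, pderiv_X]
  have horth := sum_mul_eq_zero_of_pderiv_eq_zero hF hd
  have hu : (fun i => p i 2 * p i 2) ≠ 0 := by
    intro hu
    have h2 : ∀ i, p i 2 = 0 := fun i => by simpa using congrFun hu i
    have h := sum_eval_pderiv_eq_zero hF ![((0 : Fin 4), (2 : Fin 4))] ![1] (by simp [h2])
      ![0, 1, 0, 0]
    simp [pow_two, Derivation.leibniz, pderiv_X] at h
  obtain ⟨α, hα⟩ : ∃ α, ∀ i, p i 2 * p i 3 = α * p i 2 ^ 2 := by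
    obtain ⟨g, hg0, hg⟩ := exists_relation_of_orthogonal p
      ![(0, 0), (0, 1), (0, 2), (0, 3), (1, 1), (1, 3), (2, 2), (2, 3)] hu fun _ => horth _ _
    have h := fun x y z w => sum_eval_pderiv_eq_zero hF _ g hg ![x, y, z, w]
    simp [Fin.sum_univ_succ, pow_two, Derivation.leibniz, pderiv_X, Pi.single_apply] at h
    have h0 := h 1 0 0 0
    have h1 := h 0 1 0 0
    have h3 := h 0 0 0 1
    have h01 := h 1 1 0 0
    have h02 := h 1 0 1 0
    have h03 := h 1 0 0 1
    have h13 := h 0 1 0 1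
    clear h
    simp at h0 h1 h3 h01 h02 h03 h13
    have hc : g 0 = 0 ∧ g 1 = 0 ∧ g 2 = 0 ∧ g 3 = 0 ∧ g 4 = 0 ∧ g 5 = 0 := by grind
    have hi := fun i => hg i
    simp [Fin.sum_univ_succ, hc] at hi
    have h7 : g 7 ≠ 0 := by
      intro h7
      have h6 : g 6 ≠ 0 := fun h6 => hg0 (by ext k; fin_cases k <;> simp [hc, h6, h7])
      exact hu (by ext i; simpa [h6, h7] using hi i)
    exact ⟨-g 6 / g 7, fun i => by have := hi i; field_simp; grind⟩
  obtain ⟨β, hβ⟩ : ∃ β, ∀ i, p i 3 ^ 2 - p i 1 * p i 2 = β * p i 2 ^ 2 := by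
    obtain ⟨g, hg0, hg⟩ := exists_relation_of_orthogonal p
      ![(0, 1), (0, 2), (0, 3), (1, 1), (1, 2), (1, 3), (2, 2), (3, 3)] hu fun _ => horth _ _
    have h := fun x y z w => sum_eval_pderiv_eq_zero hF _ g hg ![x, y, z, w]
    simp [Fin.sum_univ_succ, pow_two, Derivation.leibniz, pderiv_X, Pi.single_apply] at h
    have h0 := h 1 0 0 0
    have h1 := h 0 1 0 0
    have h3 := h 0 0 0 1
    have h01 := h 1 1 0 0
    have h02 := h 1 0 1 0
    have h03 := h 1 0 0 1
    have h13 := h 0 1 0 1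
    clear h
    simp at h0 h1 h3 h01 h02 h03 h13
    have hc : g 0 = 0 ∧ g 1 = 0 ∧ g 2 = 0 ∧ g 3 = 0 ∧ g 5 = 0 ∧ g 4 = -g 7 := by grind
    have hi := fun i => hg i
    simp [Fin.sum_univ_succ, hc] at hi
    have h7 : g 7 ≠ 0 := by
      intro h7
      have h6 : g 6 ≠ 0 := fun h6 => hg0 (by ext k; fin_cases k <;> simp [hc, h6, h7])
      exact hu (by ext i; simpa [h6, h7] using hi i)
    exact ⟨-g 6 / g 7, fun i => by have := hi i; field_simp; grind⟩
  have h3 : ∀ i, p i 3 = α * p i 2 := by grind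
  have h := sum_eval_pderiv_eq_zero hF ![((3 : Fin 4), (3 : Fin 4)), (2, 3)] ![1, -α]
    (fun i => by simp [h3]; ring) ![1, 1, 0, 0]
  simp [pow_two, Derivation.leibniz, pderiv_X] at h

/-- For `n = 3` (four variables), each of the quartics
`F₇ = x₀(x₀+x₁)(x₁²+x₂²+x₃²)`, `F_{8,λ} = x₀(λx₀+x₁)(x₀²+x₁²+x₂²+x₃²)` with `λ ≠ 0`,
`F₉ = x₀x₁(x₀²+x₁x₂+x₃²)` and
`F_{10,λ} = x₀(−λ²x₀+x₁+λx₂)(x₀x₁+x₂²+x₃²)` has `rk(F) ≥ 9 > 8 = 4(n−1)`. -/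
theorem stmt19 (K : Type*) [Field K] [IsAlgClosed K] [CharZero K]
    (F : MvPolynomial (Fin 4) K)
    (hF : F = X 0 * (X 0 + X 1) * sumSqFrom K 4 1 ∨
      (∃ lam : K, lam ≠ 0 ∧ F = X 0 * (C lam * X 0 + X 1) * sumSqFrom K 4 0) ∨
      F = X 0 * X 1 * ((X 0) ^ 2 + X 1 * X 2 + sumSqFrom K 4 3) ∨
      (∃ lam : K, F = X 0 * (C (-lam ^ 2) * X 0 + X 1 + C lam * X 2) *
        (X 0 * X 1 + sumSqFrom K 4 2))) :
    9 ≤ waringRank F 4 := by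
  have hX : ∀ i : Fin 4, (X i : MvPolynomial (Fin 4) K).IsHomogeneous 1 := isHomogeneous_X K
  have hCX : ∀ (c : K) (i : Fin 4), (C c * X i : MvPolynomial (Fin 4) K).IsHomogeneous 1 :=
    isHomogeneous_C_mul_X
  have key : F ∈ fourthPowerSpan K 4 ∧ ∀ p : Fin 8 → Fin 4 → K, F ≠ ∑ i, linForm (p i) ^ 4 := by
    rcases hF with rfl | ⟨lam, hlam, rfl⟩ | rfl | ⟨lam, rfl⟩
    · rw [sumSqFrom_one]
      refine ⟨?_, cone_quartic_ne_sum_pow⟩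
      have h := fun i => mul_mem_fourthPowerSpan (hX 0) ((hX 0).add (hX 1)) (hX i) (hX i)
      convert add_mem (add_mem (h 1) (h 2)) (h 3) using 1
      ring
    · rw [sumSqFrom_zero]
      refine ⟨?_, sphere_quartic_ne_sum_pow hlam⟩
      have h := fun i => mul_mem_fourthPowerSpan (hX 0) ((hCX lam 0).add (hX 1)) (hX i) (hX i)
      convert add_mem (add_mem (add_mem (h 0) (h 1)) (h 2)) (h 3) using 1
      ring
    · rw [sumSqFrom_three]
      refine ⟨?_, tangent_quartic_ne_sum_pow⟩
      have h := fun i j => mul_mem_fourthPowerSpan (hX 0) (hX 1) (hX i) (hX j)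
      convert add_mem (add_mem (h 0 0) (h 1 2)) (h 3 3) using 1
      ring
    · rw [sumSqFrom_two]
      refine ⟨?_, two_tangent_quartic_ne_sum_pow lam⟩
      have h := fun i j => mul_mem_fourthPowerSpan (hX 0)
        (((hCX (-lam ^ 2) 0).add (hX 1)).add (hCX lam 2)) (hX i) (hX j)
      convert add_mem (h 0 1) (add_mem (h 2 2) (h 3 3)) using 1
      ring
  by_contra hlt
  have hW : IsWaringDecomp F 4 (waringRank F 4) := Nat.sInf_mem (exists_isWaringDecomp key.1)
  obtain ⟨p, hp⟩ := (hW.mono (by omega : waringRank F 4 ≤ 8)).exists_eq_sum (by norm_num)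
  exact key.2 p hp
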